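/- arXiv:2107.04149 — 3 statements merged into one kernel-verified Lean document; each statement's English description precedes it below -/
import Mathlib

section
/- Let n = (n₁, n₂, n₃) ∈ ℝ³ be a unit vector and let A be the 3×3 real matrix with rows (n₁², n₁n₂ − n₃, n₁n₃ + n₂), (n₁n₂ + n₃, n₂², n₂n₃ − n₁), (n₁n₃ − n₂, n₂n₃ + n₁, n₃²). Then for every real number λ, det(λ·I + A) = (λ + 1)(λ² + 1), where I is the 3×3 identity matrix. (In particular, A has no eigenvalues on the negative real axis.) -/
open Matrix Real

theorem det_smul_one_add_rotation_pi_div_two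
    (n : Fin 3 → ℝ) (hn : n 0 ^ 2 + n 1 ^ 2 + n 2 ^ 2 = 1)
    (A : Matrix (Fin 3) (Fin 3) ℝ)
    (hA : A = !![n 0 ^ 2, n 0 * n 1 - n 2, n 0 * n 2 + n 1;
                 n 0 * n 1 + n 2, n 1 ^ 2, n 1 * n 2 - n 0;
                 n 0 * n 2 - n 1, n 1 * n 2 + n 0, n 2 ^ 2])
    (lam : ℝ) :
    (lam • (1 : Matrix (Fin 3) (Fin 3) ℝ) + A).det = (lam + 1) * (lam ^ 2 + 1) := by
  subst hA
  rw [one_fin_three, det_fin_three]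
  simp
  linear_combination (lam ^ 2 + lam + n 0 ^ 2 + n 1 ^ 2 + n 2 ^ 2 + 1) * hn
end

section
/- Let n = (n₁, n₂, n₃) ∈ ℝ³ be a unit vector (write a = n₁, b = n₂, c = n₃) and let A be the 3×3 real matrix with rows (a², ab − c, ac + b), (ab + c, b², bc − a), (ac − b, bc + a, c²). Then for every real λ ≥ 0, A · (λ·I + A)⁻¹ = (1/((λ+1)(λ²+1))) · N, where N is the 3×3 matrix with rows (a²λ(λ−1) + 1 + λ, abλ(λ−1) − cλ(1+λ), acλ(λ−1) + bλ(1+λ)), (abλ(λ−1) + cλ(1+λ), b²λ(λ−1) + 1 + λ, bcλ(λ−1) − aλ(1+λ)), (acλ(λ−1) − bλ(1+λ), bcλ(λ−1) + aλ(1+λ), c²λ(λ−1) + 1 + λ). -/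
open Matrix Real

theorem mul_inv_smul_one_add_rotation_pi_div_two
    (a b c : ℝ) (hn : a ^ 2 + b ^ 2 + c ^ 2 = 1)
    (A : Matrix (Fin 3) (Fin 3) ℝ)
    (hA : A = !![a ^ 2, a * b - c, a * c + b;
                 a * b + c, b ^ 2, b * c - a;
                 a * c - b, b * c + a, c ^ 2])
    (lam : ℝ) (hlam : 0 ≤ lam) :
    A * (lam • (1 : Matrix (Fin 3) (Fin 3) ℝ) + A)⁻¹ =
      (1 / ((lam + 1) * (lam ^ 2 + 1))) •
        !![a ^ 2 * lam * (lam - 1) + 1 + lam, a * b * lam * (lam - 1) - c * lam * (1 + lam),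
             a * c * lam * (lam - 1) + b * lam * (1 + lam);
           a * b * lam * (lam - 1) + c * lam * (1 + lam), b ^ 2 * lam * (lam - 1) + 1 + lam,
             b * c * lam * (lam - 1) - a * lam * (1 + lam);
           a * c * lam * (lam - 1) - b * lam * (1 + lam), b * c * lam * (lam - 1) + a * lam * (1 + lam),
             c ^ 2 * lam * (lam - 1) + 1 + lam] := by
  subst hA
  have hd : (lam + 1) * (lam ^ 2 + 1) ≠ 0 := by positivity
  have hdet : IsUnit (lam • (1 : Matrix (Fin 3) (Fin 3) ℝ) +
      !![a ^ 2, a * b - c, a * c + b;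
         a * b + c, b ^ 2, b * c - a;
         a * c - b, b * c + a, c ^ 2]).det := by
    refine isUnit_iff_ne_zero.mpr (ne_of_eq_of_ne ?_ hd)
    simp [det_fin_three, one_apply]
    linear_combination (lam ^ 2 + lam + (a ^ 2 + b ^ 2 + c ^ 2) + 1) * hn
  let _ := invertibleOfIsUnitDet _ hdet
  rw [mul_inv_eq_iff_eq_mul_of_invertible, smul_mul, one_div, eq_inv_smul_iff₀ hd]
  ext i j
  fin_cases i <;> fin_cases j <;> simp [mul_apply, Fin.sum_univ_three, one_apply] <;> grind
end

section
/- Let n = (n₁, n₂, n₃) ∈ ℝ³ be a unit vector and let A be the 3×3 real matrix with rows (n₁², n₁n₂ − n₃, n₁n₃ + n₂), (n₁n₂ + n₃, n₂², n₂n₃ − n₁), (n₁n₃ − n₂, n₂n₃ + n₁, n₃²). For 0 < α < 1, the Balakrishnan fractional power A^α := (sin(απ)/π) ∫₀^∞ λ^{α−1} A(λI + A)^{−1} dλ (the integral taken entrywise over (0,∞)) equals the Rodrigues rotation matrix R(n, απ/2), i.e. the 3×3 matrix with rows (n₁²(1−cos(απ/2)) + cos(απ/2), n₁n₂(1−cos(απ/2))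 − n₃ sin(απ/2), n₁n₃(1−cos(απ/2)) + n₂ sin(απ/2)), (n₁n₂(1−cos(απ/2)) + n₃ sin(απ/2), n₂²(1−cos(απ/2)) + cos(απ/2), n₂n₃(1−cos(απ/2)) − n₁ sin(απ/2)), (n₁n₃(1−cos(απ/2)) − n₂ sin(απ/2), n₂n₃(1−cos(απ/2)) + n₁ sin(απ/2), n₃²(1−cos(απ/2)) + cos(απ/2)). -/
open Matrix Real MeasureTheory

/-- The Mellin transform of `x ↦ 1 / (1 + x)`, obtained from the reflection formula by writing
`1 / (1 + x)` as a Laplace transform. -/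
theorem integral_rpow_div_one_add {s : ℝ} (h0 : 0 < s) (h1 : s < 1) :
    ∫ x in Set.Ioi (0 : ℝ), x ^ (s - 1) / (1 + x) = π / sin (π * s) := by
  have laplace : ∀ x ∈ Set.Ioi (0 : ℝ),
      ∫ t in Set.Ioi (0 : ℝ), x ^ (s - 1) * exp (-(1 + x) * t) = x ^ (s - 1) / (1 + x) := by
    intro x hx
    have hx' : 0 < 1 + x := add_pos one_pos hx
    rw [integral_const_mul, integral_exp_mul_Ioi (by linarith)]
    simp [div_eq_mul_inv, -neg_add_rev]
  have integrable : IntegrableOn (fun x : ℝ => x ^ (s - 1) / (1 + x)) (Set.Ioi 0) := by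
    refine (integrableOn_rpowIntegrand₀₁_Ioi ⟨h0, h1⟩ zero_le_one).congr_fun ?_ measurableSet_Ioi
    intro x hx
    simpa [add_comm] using rpowIntegrand₀₁_eqOn_pow_div ⟨h0, h1⟩ zero_le_one hx
  have swap := integral_integral_swap
    (f := fun x t : ℝ => x ^ (s - 1) * exp (-(1 + x) * t))
    (μ := volume.restrict (Set.Ioi 0)) (ν := volume.restrict (Set.Ioi 0)) <| by
      refine (integrable_prod_iff (Measurable.aestronglyMeasurable (by
        unfold Function.uncurry; fun_prop))).mpr ⟨?_, ?_⟩
      · filter_upwards [ae_restrict_mem measurableSet_Ioi] with x hx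
        exact (integrableOn_exp_mul_Ioi
          (by linarith [Set.mem_Ioi.mp hx] : -(1 + x) < 0) 0).const_mul (x ^ (s - 1))
      · refine integrable.congr ?_
        filter_upwards [ae_restrict_mem measurableSet_Ioi] with x hx
        rw [← laplace x hx]
        refine integral_congr_ae (ae_of_all _ fun t => ?_)
        have : 0 < x := hx
        simp only [Function.uncurry]
        rw [norm_of_nonneg (by positivity)]
  rw [setIntegral_congr_fun measurableSet_Ioi laplace] at swap
  rw [swap, ← Gamma_mul_Gamma_one_sub, Gamma_eq_integral (by linarith : 0 < 1 - s),
    ← integral_const_mul]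
  refine setIntegral_congr_fun measurableSet_Ioi fun t ht => ?_
  have split : ∀ x : ℝ, x ^ (s - 1) * exp (-(1 + x) * t) =
      exp (-t) * (x ^ (s - 1) * exp (-(t * x))) := by
    intro x
    rw [show -(1 + x) * t = -t + -(t * x) by ring, exp_add]
    ring
  simp only [split]
  rw [integral_const_mul, integral_rpow_mul_exp_neg_mul_Ioi h0 ht, one_div,
    inv_rpow (le_of_lt ht), ← rpow_neg (le_of_lt ht), show 1 - s - 1 = -s by ring]
  ring

/-- The Mellin transform of `x ↦ 1 / (1 + x ^ 2)`. -/
theorem integral_rpow_div_one_add_sq {s : ℝ} (h0 : 0 < s) (h2 : s < 2) :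
    ∫ x in Set.Ioi (0 : ℝ), x ^ (s - 1) / (1 + x ^ 2) = π / 2 / sin (π * s / 2) := by
  have key := integral_comp_rpow_Ioi_of_pos
    (g := fun y : ℝ => y ^ (s / 2 - 1) / (1 + y)) two_pos
  rw [integral_rpow_div_one_add (by linarith) (by linarith)] at key
  have subst : ∀ x ∈ Set.Ioi (0 : ℝ),
      (2 * x ^ ((2 : ℝ) - 1)) • ((x ^ (2 : ℝ)) ^ (s / 2 - 1) / (1 + x ^ (2 : ℝ))) =
        2 * (x ^ (s - 1) / (1 + x ^ 2)) := by
    intro x hx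
    rw [← rpow_mul (le_of_lt hx), rpow_two, smul_eq_mul,
      show s - 1 = (2 - 1) + 2 * (s / 2 - 1) by ring, rpow_add hx]
    ring
  rw [setIntegral_congr_fun measurableSet_Ioi subst, integral_const_mul, ← mul_div_assoc] at key
  rw [div_right_comm, ← key]
  ring

theorem sin_mul_pi_pos {s : ℝ} (h0 : 0 < s) (h1 : s < 1) : 0 < sin (π * s) :=
  sin_pos_of_pos_of_lt_pi (by positivity) (by nlinarith [pi_pos])

theorem integrableOn_rpow_div_one_add {s : ℝ} (h0 : 0 < s) (h1 : s < 1) :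
    IntegrableOn (fun x : ℝ => x ^ (s - 1) / (1 + x)) (Set.Ioi 0) := by
  refine .of_integral_ne_zero ?_
  rw [integral_rpow_div_one_add h0 h1]
  have := sin_mul_pi_pos h0 h1
  positivity

theorem integrableOn_rpow_div_one_add_sq {s : ℝ} (h0 : 0 < s) (h2 : s < 2) :
    IntegrableOn (fun x : ℝ => x ^ (s - 1) / (1 + x ^ 2)) (Set.Ioi 0) := by
  refine .of_integral_ne_zero ?_
  rw [integral_rpow_div_one_add_sq h0 h2]
  have := sin_mul_pi_pos (s := s / 2) (by linarith) (by linarith)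
  rw [mul_div_assoc]
  positivity

/-- The Balakrishnan integral of `a / (1 + x) + (b + c * x) / (1 + x ^ 2)`: the eigenvalue `1`
contributes `a`, the eigenvalues `± i` contribute `b` and `c`. -/
theorem balakrishnan_integral_one_and_I {α : ℝ} (h0 : 0 < α) (h1 : α < 1) (a b c : ℝ) :
    sin (α * π) / π * ∫ x in Set.Ioi (0 : ℝ),
        x ^ (α - 1) * ((1 + x)⁻¹ * a + (1 + x ^ 2)⁻¹ * b + x * (1 + x ^ 2)⁻¹ * c) =
      a + cos (α * π / 2) * b + sin (α * π / 2) * c := by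
  have split : ∀ x ∈ Set.Ioi (0 : ℝ),
      x ^ (α - 1) * ((1 + x)⁻¹ * a + (1 + x ^ 2)⁻¹ * b + x * (1 + x ^ 2)⁻¹ * c) =
        x ^ (α - 1) / (1 + x) * a + x ^ (α - 1) / (1 + x ^ 2) * b +
          x ^ (α + 1 - 1) / (1 + x ^ 2) * c := by
    intro x hx
    rw [show α + 1 - 1 = (α - 1) + 1 by ring, rpow_add hx, rpow_one]
    ring
  have ia := (integrableOn_rpow_div_one_add h0 h1).mul_const a
  have ib := (integrableOn_rpow_div_one_add_sq h0 (by linarith)).mul_const b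
  have ic := (integrableOn_rpow_div_one_add_sq (s := α + 1)
    (by linarith) (by linarith)).mul_const c
  rw [setIntegral_congr_fun measurableSet_Ioi split, integral_add (by exact ia.add ib) ic,
    integral_add ia ib, integral_mul_const, integral_mul_const, integral_mul_const,
    integral_rpow_div_one_add h0 h1, integral_rpow_div_one_add_sq h0 (by linarith),
    integral_rpow_div_one_add_sq (by linarith) (by linarith),
    show π * (α + 1) / 2 = α * π / 2 + π / 2 by ring, sin_add_pi_div_two, mul_comm π α]
  have double : sin (α * π) = 2 * sin (α * π / 2) * cos (α * π / 2) := by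
    rw [← sin_two_mul]
    ring_nf
  have hs : sin (α * π / 2) ≠ 0 := (sin_pos_of_pos_of_lt_pi (by positivity)
    (by nlinarith [pi_pos])).ne'
  have hc : cos (α * π / 2) ≠ 0 := (cos_pos_of_mem_Ioo
    ⟨by nlinarith [pi_pos, mul_pos h0 pi_pos], by nlinarith [pi_pos]⟩).ne'
  rw [double]
  field_simp

/-- If `P` is a projection and `K` a complex structure on its complement, the Yosida-type
resolvent of `P + K` splits along the eigenvalues `1` and `± i`. -/
theorem mul_inv_smul_one_add_of_projection_add_complexStructure {m : Type*} [Fintype m]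
    [DecidableEq m] {P K : Matrix m m ℝ} (hPP : P * P = P) (hPK : P * K = 0) (hKP : K * P = 0)
    (hKK : K * K = P - 1) {x : ℝ} (hx : 0 < x) :
    (P + K) * (x • (1 : Matrix m m ℝ) + (P + K))⁻¹ =
      (1 + x)⁻¹ • P + (1 + x ^ 2)⁻¹ • (1 - P) + (x * (1 + x ^ 2)⁻¹) • K := by
  have inv : (x • (1 : Matrix m m ℝ) + (P + K))⁻¹ =
      (1 + x)⁻¹ • P + (x * (1 + x ^ 2)⁻¹) • (1 - P) - (1 + x ^ 2)⁻¹ • K := by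
    refine inv_eq_right_inv ?_
    simp only [add_mul, mul_add, mul_sub, smul_mul_assoc, mul_smul_comm, one_mul, mul_one,
      hPP, hPK, hKP, hKK]
    match_scalars <;> field_simp <;> ring
  rw [inv]
  simp only [add_mul, mul_add, mul_sub, mul_smul_comm, mul_one, hPP, hPK, hKP, hKK]
  match_scalars <;> field_simp <;> ring

theorem balakrishnan_fractional_power_eq_rodrigues
    (n : Fin 3 → ℝ) (hn : n 0 ^ 2 + n 1 ^ 2 + n 2 ^ 2 = 1)
    (A : Matrix (Fin 3) (Fin 3) ℝ)
    (hA : A = !![n 0 ^ 2, n 0 * n 1 - n 2, n 0 * n 2 + n 1;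
                 n 0 * n 1 + n 2, n 1 ^ 2, n 1 * n 2 - n 0;
                 n 0 * n 2 - n 1, n 1 * n 2 + n 0, n 2 ^ 2])
    (α : ℝ) (h0 : 0 < α) (h1 : α < 1) :
    (Matrix.of fun i j : Fin 3 =>
        (Real.sin (α * π) / π) *
          ∫ l in Set.Ioi (0 : ℝ),
            l ^ (α - 1) * ((A * (l • (1 : Matrix (Fin 3) (Fin 3) ℝ) + A)⁻¹) i j)) =
      !![n 0 ^ 2 * (1 - Real.cos (α * π / 2)) + Real.cos (α * π / 2),
           n 0 * n 1 * (1 - Real.cos (α * π / 2)) - n 2 * Real.sin (α * π / 2),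
           n 0 * n 2 * (1 - Real.cos (α * π / 2)) + n 1 * Real.sin (α * π / 2);
         n 0 * n 1 * (1 - Real.cos (α * π / 2)) + n 2 * Real.sin (α * π / 2),
           n 1 ^ 2 * (1 - Real.cos (α * π / 2)) + Real.cos (α * π / 2),
           n 1 * n 2 * (1 - Real.cos (α * π / 2)) - n 0 * Real.sin (α * π / 2);
         n 0 * n 2 * (1 - Real.cos (α * π / 2)) - n 1 * Real.sin (α * π / 2),
           n 1 * n 2 * (1 - Real.cos (α * π / 2)) + n 0 * Real.sin (α * π / 2),
           n 2 ^ 2 * (1 - Real.cos (α * π / 2)) + Real.cos (α * π / 2)] := by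
  set P : Matrix (Fin 3) (Fin 3) ℝ := vecMulVec n n with hP
  set K : Matrix (Fin 3) (Fin 3) ℝ := !![0, -n 2, n 1; n 2, 0, -n 0; -n 1, n 0, 0] with hK
  have hAPK : A = P + K := by
    rw [hA]
    ext i j
    fin_cases i <;> fin_cases j <;> simp [hP, hK, vecMulVec_apply] <;> ring
  have hPP : P * P = P := by
    ext i j
    simp only [hP, mul_apply, Fin.sum_univ_three, vecMulVec_apply]
    linear_combination n i * n j * hn
  have hPK : P * K = 0 := by
    ext i j
    fin_cases j <;> simp [hP, hK, mul_apply, Fin.sum_univ_three, vecMulVec_apply] <;> ring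
  have hKP : K * P = 0 := by
    ext i j
    fin_cases i <;> simp [hP, hK, mul_apply, Fin.sum_univ_three, vecMulVec_apply] <;> ring
  have hKK : K * K = P - 1 := by
    ext i j
    fin_cases i <;> fin_cases j <;>
      simp [hP, hK, mul_apply, Fin.sum_univ_three, vecMulVec_apply] <;> linarith
  have power : (Matrix.of fun i j : Fin 3 => sin (α * π) / π * ∫ l in Set.Ioi (0 : ℝ),
      l ^ (α - 1) * ((A * (l • (1 : Matrix (Fin 3) (Fin 3) ℝ) + A)⁻¹) i j)) =
      P + cos (α * π / 2) • (1 - P) + sin (α * π / 2) • K := by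
    ext i j
    simp only [of_apply, Matrix.add_apply, Matrix.smul_apply, smul_eq_mul]
    rw [← balakrishnan_integral_one_and_I h0 h1]
    congr 1
    refine setIntegral_congr_fun measurableSet_Ioi fun l hl => ?_
    simp only [hAPK, mul_inv_smul_one_add_of_projection_add_complexStructure hPP hPK hKP hKK hl,
      Matrix.add_apply, Matrix.smul_apply, smul_eq_mul]
  rw [power]
  ext i j
  fin_cases i <;> fin_cases j <;> simp [hP, hK, vecMulVec_apply] <;> ring
end
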